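/- Let 0 < a and 0 < b be real constants with a + b < 1 and let β = (8/7)^{1/12}. There exist c > 0 and N such that for every n ≥ N, every ⌊n^a⌋-SMNBP representing ψ(K_n) has at least c·β^{n^b} edges, where K_n is the complete graph on n vertices. -/

import Mathlib

/-- The variables of the CNF `ψ(G)`: vertex variables and edge variables. -/
abbrev PsiVar (V : Type) := V ⊕ Sym2 V

/-- A total assignment to the variables of `ψ(G)`. -/
abbrev Assignment (V : Type) := PsiVar V → Bool

/-- `σ` satisfies the CNF `ψ(G)` whose clauses are `(u ∨ e ∨ v)`
for the edges `e = {u,v}` of `G`. -/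
def psiSat {V : Type} (G : SimpleGraph V) (σ : Assignment V) : Prop :=
  ∀ ⦃u v : V⦄, G.Adj u v →
    σ (Sum.inl u) = true ∨ σ (Sum.inr s(u, v)) = true ∨ σ (Sum.inl v) = true

/-- A (nondeterministic) branching program: a directed multigraph on `Fin n`
with edge set `Fin m`, a source, a sink, and an optional literal labelling
each edge. -/
structure BP (X : Type) where
  n : ℕ
  m : ℕ
  esrc : Fin m → Fin n
  edst : Fin m → Fin n
  source : Fin n
  sink : Fin n
  label : Fin m → Option (X × Bool)

namespace BP

variable {X : Type}

/-- `Z.IsPathFrom u v p`: the edge list `p` forms a directed path from `u` to `v`. -/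
def IsPathFrom (Z : BP X) : Fin Z.n → Fin Z.n → List (Fin Z.m) → Prop
  | u, v, [] => u = v
  | u, v, e :: p => Z.esrc e = u ∧ Z.IsPathFrom (Z.edst e) v p

/-- `v` is reachable from `u`. -/
def Reach (Z : BP X) (u v : Fin Z.n) : Prop := ∃ p, Z.IsPathFrom u v p

/-- `Z` is acyclic. -/
def Acyclic (Z : BP X) : Prop :=
  ∀ (u : Fin Z.n) (p : List (Fin Z.m)), Z.IsPathFrom u u p → p = []

/-- `Z` is a DAG with one source and one sink: no edge enters the source, no edge
leaves the sink, and every vertex lies on a source-sink path. -/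
def IsNBP (Z : BP X) : Prop :=
  Z.Acyclic ∧ (∀ e, Z.edst e ≠ Z.source) ∧ (∀ e, Z.esrc e ≠ Z.sink) ∧
    ∀ v : Fin Z.n, Z.Reach Z.source v ∧ Z.Reach v Z.sink

/-- The number of edges of the path `p` labelled with a literal of variable `x`. -/
def varCount [DecidableEq X] (Z : BP X) (p : List (Fin Z.m)) (x : X) : ℕ :=
  p.countP fun e => (Z.label e).elim false fun l => decide (l.1 = x)

/-- A path is read-once if no variable labels two of its edges. -/
def ReadOnce [DecidableEq X] (Z : BP X) (p : List (Fin Z.m)) : Prop :=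
  ∀ x : X, Z.varCount p x ≤ 1

/-- `Z` is a syntactic read-`d`-times BP. -/
def ReadTimes [DecidableEq X] (Z : BP X) (d : ℕ) : Prop :=
  ∀ (u v : Fin Z.n) (p : List (Fin Z.m)), Z.IsPathFrom u v p → ∀ x : X, Z.varCount p x ≤ d

/-- `Z` is monotone: no negative literal labels an edge. -/
def MonotoneBP (Z : BP X) : Prop :=
  ∀ (e : Fin Z.m) (l : X × Bool), Z.label e = some l → l.2 = true

/-- `Z` is separable with parameter `d`: every source-sink path is the
concatenation of at most `d` read-once subpaths. -/
def Separable [DecidableEq X] (Z : BP X) (d : ℕ) : Prop :=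
  ∀ p, Z.IsPathFrom Z.source Z.sink p →
    ∃ ps : List (List (Fin Z.m)), ps.length ≤ d ∧ ps.flatten = p ∧ ∀ q ∈ ps, Z.ReadOnce q

/-- `Z` is a monotone separable syntactic read-`d`-times NBP. -/
def IsSMNBP [DecidableEq X] (Z : BP X) (d : ℕ) : Prop :=
  Z.IsNBP ∧ Z.MonotoneBP ∧ Z.ReadTimes d ∧ Z.Separable d

/-- The path `p` agrees with the total assignment `σ` (so `p` is consistent
and its set of literals is contained in `σ`). -/
def PathAgrees (Z : BP X) (p : List (Fin Z.m)) (σ : X → Bool) : Prop :=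
  ∀ e ∈ p, ∀ l : X × Bool, Z.label e = some l → σ l.1 = l.2

/-- `σ` is a satisfying assignment of `Z`: some consistent source-sink path
carries it. -/
def Sat (Z : BP X) (σ : X → Bool) : Prop :=
  ∃ p, Z.IsPathFrom Z.source Z.sink p ∧ Z.PathAgrees p σ

end BP

/-- `Z` represents the CNF `ψ(G)`. -/
def RepresentsPsi {V : Type} (G : SimpleGraph V) (Z : BP (PsiVar V)) : Prop :=
  ∀ σ : Assignment V, Z.Sat σ ↔ psiSat G σ

open Finset in
/-- A finite relation with many related pairs has a subset `A` of large minimum degree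
that no set of at most `k` points disconnects. -/
theorem exists_highly_connected_subset {V : Type} [Fintype V] [DecidableEq V]
    (R : V → V → Prop) [DecidableRel R] (hsymm : ∀ u v, R u v → R v u) (k : ℕ)
    (hcard : 2 * k ≤ Fintype.card V)
    (h : 4 * k * Fintype.card V < #{p : V × V | R p.1 p.2} + 4 * k * k) :
    ∃ A : Finset V, 2 * k < #A ∧ (∀ u ∈ A, 2 * k < #{v ∈ A | R u v}) ∧
      ∀ (D : Finset V) (P : V → Prop), #D ≤ k →
        (∀ u ∈ A, u ∉ D → P u → ∀ w ∈ A, w ∉ D → ¬ P w → ¬ R u w) →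
        (∀ u ∈ A, u ∉ D → P u) ∨ (∀ u ∈ A, u ∉ D → ¬ P u) := by
  classical
  let Q : Finset V → Prop := fun A =>
    2 * k ≤ #A ∧ 4 * k * #A < #{p ∈ A ×ˢ A | R p.1 p.2} + 4 * k * k
  obtain ⟨A, hA⟩ := exists_minimal_of_wellFoundedLT Q
    ⟨univ, by simpa [Q] using ⟨hcard, h⟩⟩
  obtain ⟨hQ, hmin⟩ : Q A ∧ ∀ B, B ⊂ A → ¬ Q B :=
    ⟨hA.prop, fun B hB hQB => hA.not_prop_of_lt hB hQB⟩
  have hlt : 2 * k < #A := by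
    refine lt_of_le_of_ne hQ.1 fun heq => ?_
    have h1 : #{p ∈ A ×ˢ A | R p.1 p.2} ≤ #A * #A :=
      (card_filter_le _ _).trans (card_product A A).le
    have h2 := hQ.2
    rw [← heq] at h1 h2
    nlinarith
  have hdeg : ∀ u ∈ A, 2 * k < #{v ∈ A | R u v} := by
    intro u hu
    by_contra! hle
    apply hmin (A.erase u) (erase_ssubset hu)
    have hc : #(A.erase u) + 1 = #A := card_erase_add_one hu
    refine ⟨by omega, ?_⟩
    have hsub : ({p ∈ A ×ˢ A | R p.1 p.2} : Finset (V × V)) ⊆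
        ({p ∈ A.erase u ×ˢ A.erase u | R p.1 p.2} : Finset (V × V)) ∪
        (({v ∈ A | R u v} : Finset V).image (fun v => (u, v)) ∪
          ({v ∈ A | R u v} : Finset V).image (fun v => (v, u))) := by
      rintro ⟨x, y⟩ hxy
      simp only [mem_filter, mem_product] at hxy
      obtain ⟨⟨hx, hy⟩, hR⟩ := hxy
      by_cases hxu : x = u
      · subst hxu; simp [hy, hR]
      · by_cases hyu : y = u
        · subst hyu; simp [hx, hsymm _ _ hR]
        · simp [hx, hy, hR, hxu, hyu]
    have h1 := card_le_card hsub
    have h2 := card_union_le ({p ∈ A.erase u ×ˢ A.erase u | R p.1 p.2} : Finset (V × V))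
        (({v ∈ A | R u v} : Finset V).image (fun v => (u, v)) ∪
          ({v ∈ A | R u v} : Finset V).image (fun v => (v, u)))
    have h3 := card_union_le (({v ∈ A | R u v} : Finset V).image (fun v => (u, v)))
          (({v ∈ A | R u v} : Finset V).image (fun v => (v, u)))
    have h4 : #(({v ∈ A | R u v} : Finset V).image (fun v => (u, v))) ≤ _ := card_image_le
    have h5 : #(({v ∈ A | R u v} : Finset V).image (fun v => (v, u))) ≤ _ := card_image_le
    have h6 := hQ.2
    rw [← hc] at h6
    nlinarith
  refine ⟨A, hlt, hdeg, fun D P hD hsep => ?_⟩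
  by_contra! hcon
  obtain ⟨⟨a, haA, haD, haP⟩, ⟨b, hbA, hbD, hbP⟩⟩ := hcon
  have small : ∀ (P' : V → Prop) [DecidablePred P'],
      (∀ u ∈ A, u ∉ D → P' u → ∀ w ∈ A, w ∉ D → ¬ P' w → ¬ R u w) →
      (∃ u ∈ A, u ∉ D ∧ P' u) → (∃ u ∈ A, u ∉ D ∧ ¬ P' u) →
      #{p ∈ ({u ∈ A | u ∈ D ∨ P' u} : Finset V) ×ˢ ({u ∈ A | u ∈ D ∨ P' u} : Finset V)
        | R p.1 p.2} + 4 * k * k ≤ 4 * k * #{u ∈ A | u ∈ D ∨ P' u} := by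
    rintro P' _ hs ⟨u, huA, huD, huP⟩ ⟨w, hwA, hwD, hwP⟩
    have hss : ({u ∈ A | u ∈ D ∨ P' u} : Finset V) ⊂ A := by
      refine (ssubset_iff_of_subset (filter_subset _ _)).2 ⟨w, hwA, ?_⟩
      simp [hwD, hwP]
    by_contra! hlt'
    refine hmin _ hss ⟨?_, hlt'⟩
    refine (hdeg u huA).le.trans (card_le_card ?_)
    intro v hv
    simp only [mem_filter] at hv ⊢
    refine ⟨hv.1, ?_⟩
    by_contra! hv'
    exact hs u huA huD huP v hv.1 hv'.1 hv'.2 hv.2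
  have s1 := small P hsep ⟨b, hbA, hbD, hbP⟩ ⟨a, haA, haD, haP⟩
  have s2 := small (fun u => ¬ P u)
    (fun u hu huD hup w hw hwD hwp hr => hsep w hw hwD (not_not.1 hwp) u hu huD hup (hsymm _ _ hr))
    ⟨a, haA, haD, haP⟩ ⟨b, hbA, hbD, not_not.2 hbP⟩
  have hcards : #{u ∈ A | u ∈ D ∨ P u} + #{u ∈ A | u ∈ D ∨ ¬ P u} ≤ #A + k := by
    rw [← card_union_add_card_inter]
    refine Nat.add_le_add (card_le_card ?_) ((card_le_card ?_).trans hD)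
    · exact union_subset (filter_subset _ _) (filter_subset _ _)
    · intro u hu
      simp only [mem_inter, mem_filter] at hu
      tauto
  have hedges : #{p ∈ A ×ˢ A | R p.1 p.2} ≤
      #{p ∈ ({u ∈ A | u ∈ D ∨ P u} : Finset V) ×ˢ ({u ∈ A | u ∈ D ∨ P u} : Finset V)
        | R p.1 p.2} +
      #{p ∈ ({u ∈ A | u ∈ D ∨ ¬ P u} : Finset V) ×ˢ ({u ∈ A | u ∈ D ∨ ¬ P u} : Finset V)
        | R p.1 p.2} := by
    refine (card_le_card ?_).trans (card_union_le _ _)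
    rintro ⟨x, y⟩ hxy
    simp only [mem_filter, mem_product] at hxy
    obtain ⟨⟨hx, hy⟩, hR⟩ := hxy
    have e1 : ¬ (x ∉ D ∧ y ∉ D ∧ P x ∧ ¬ P y) :=
      fun ⟨hxD, hyD, hxP, hyP⟩ => hsep x hx hxD hxP y hy hyD hyP hR
    have e2 : ¬ (x ∉ D ∧ y ∉ D ∧ P y ∧ ¬ P x) :=
      fun ⟨hxD, hyD, hyP, hxP⟩ => hsep y hy hyD hyP x hx hxD hxP (hsymm _ _ hR)
    simp only [mem_union, mem_filter, mem_product, hx, hy, hR, true_and, and_true]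
    clear * - e1 e2
    tauto
  have hmul := Nat.mul_le_mul_left (4 * k) hcards
  have hbig := hQ.2
  rw [mul_add, mul_add] at hmul
  linarith

/-- The set `S` contains the centre of the triple `c` and neither of its other points. -/
def CentreOnly {V : Type} (S : Finset V) (c : V × V × V) : Prop :=
  c.1 ∈ S ∧ c.2.1 ∉ S ∧ c.2.2 ∉ S

/-- The set of points of a triple. -/
def tripleSupport {V : Type} [DecidableEq V] (c : V × V × V) : Finset V := {c.1, c.2.1, c.2.2}

/-- The three points of a triple are distinct. -/
def DistinctTriple {V : Type} (c : V × V × V) : Prop :=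
  c.1 ≠ c.2.1 ∧ c.1 ≠ c.2.2 ∧ c.2.1 ≠ c.2.2

open Finset in
theorem card_not_centreOnly_le {V : Type} [DecidableEq V] (c : V × V × V)
    (hc : DistinctTriple c) (F Q : Finset (Finset V)) (hFQ : F ⊆ Q)
    (hF : ∀ S ∈ F, ¬ CentreOnly S c)
    (hQ : ∀ S T : Finset V, S \ tripleSupport c = T \ tripleSupport c → S ∈ Q → T ∈ Q) :
    8 * #F ≤ 7 * #Q := by
  obtain ⟨u, v, w⟩ := c
  obtain ⟨huv, huw, hvw⟩ := hc
  simp only at huv huw hvw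
  have hmain : #Q ≤ 8 * #(Q \ F) := by
    refine card_le_mul_card_image_of_maps_to
      (f := fun S : Finset V => insert u (S \ {v, w})) ?_ 8 ?_
    · intro S hS
      refine mem_sdiff.2 ⟨hQ S _ ?_ hS, fun h => hF _ h ?_⟩
      · ext x
        simp only [tripleSupport, mem_sdiff, mem_insert, mem_singleton]
        tauto
      · simp [CentreOnly, huv.symm, huw.symm]
    · intro T _
      have hp : #(({u, v, w} : Finset V).powerset) = 8 := by
        rw [card_powerset, card_eq_three.2 ⟨u, v, w, huv, huw, hvw, rfl⟩]; rfl
      rw [← hp]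
      refine card_le_card_of_injOn (fun S => S ∩ {u, v, w}) ?_ ?_
      · intro S _; simp
      · intro S hS S' hS' heq
        have hTT := (mem_filter.1 hS).2.trans (mem_filter.1 hS').2.symm
        ext x
        have h1 := Finset.ext_iff.1 hTT x
        have h2 := Finset.ext_iff.1 heq x
        simp only [mem_inter, mem_insert, mem_sdiff, mem_singleton] at h1 h2
        by_cases hx : x = u ∨ x = v ∨ x = w
        · simpa [hx] using h2
        · push Not at hx
          simpa [hx.1, hx.2.1, hx.2.2] using h1
  have := card_sdiff_add_card_eq_card hFQ
  omega

open Finset in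
theorem card_forall_not_centreOnly_le {V : Type} [Fintype V] [DecidableEq V]
    (l : List (V × V × V)) (hl : ∀ c ∈ l, DistinctTriple c)
    (hd : l.Pairwise fun c c' => Disjoint (tripleSupport c) (tripleSupport c'))
    (F : Finset (Finset V)) (hF : ∀ S ∈ F, ∀ c ∈ l, ¬ CentreOnly S c) :
    8 ^ l.length * #F ≤ 7 ^ l.length * 2 ^ Fintype.card V := by
  classical
  induction l generalizing F with
  | nil => simpa using card_le_univ F
  | cons c l ih =>
    rw [List.pairwise_cons] at hd
    let Q : Finset (Finset V) := {S | ∀ c ∈ l, ¬ CentreOnly S c}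
    have ih := ih (fun c' h => hl c' (List.mem_cons_of_mem _ h)) hd.2 Q
      (fun S hS => (mem_filter.1 hS).2)
    have hstep := card_not_centreOnly_le c (hl c List.mem_cons_self) F Q
      (fun S hS => mem_filter.2
        ⟨mem_univ _, fun c' hc' => hF S hS c' (List.mem_cons_of_mem _ hc')⟩)
      (fun S hS => hF S hS c List.mem_cons_self) (by
        intro S T hST hS
        refine mem_filter.2 ⟨mem_univ _, fun c' hc' hT => ?_⟩
        have hdis := hd.1 c' hc'
        have hiff : ∀ x ∈ tripleSupport c', x ∈ T ↔ x ∈ S := by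
          intro x hx
          have hx' : x ∉ tripleSupport c := fun h => (disjoint_left.1 hdis h) hx
          have := Finset.ext_iff.1 hST x
          simp only [mem_sdiff, hx', not_false_eq_true, and_true] at this
          exact this.symm
        apply (mem_filter.1 hS).2 c' hc'
        obtain ⟨h1, h2, h3⟩ := hT
        refine ⟨(hiff _ ?_).1 h1, fun h => h2 ((hiff _ ?_).2 h), fun h => h3 ((hiff _ ?_).2 h)⟩ <;>
        simp [tripleSupport])
    simp only [List.length_cons, pow_succ]
    calc 8 ^ l.length * 8 * #F = 8 ^ l.length * (8 * #F) := by ring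
      _ ≤ 8 ^ l.length * (7 * #Q) := Nat.mul_le_mul_left _ hstep
      _ = 7 * (8 ^ l.length * #Q) := by ring
      _ ≤ 7 * (7 ^ l.length * 2 ^ Fintype.card V) := Nat.mul_le_mul_left _ ih
      _ = _ := by ring

open Finset in
/-- Greedy packing: either there are `t` pairwise disjoint triples with property `C`, or at most
`3 * t` points meet all of them. -/
theorem exists_packing_or_cover {V : Type} [DecidableEq V] (C : V × V × V → Prop) (t : ℕ) :
    (∃ l : List (V × V × V), l.length = t ∧ (∀ c ∈ l, C c) ∧
      l.Pairwise fun c c' => Disjoint (tripleSupport c) (tripleSupport c')) ∨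
    ∃ D : Finset V, #D ≤ 3 * t ∧ ∀ c, C c → ¬ Disjoint (tripleSupport c) D := by
  induction t with
  | zero => exact Or.inl ⟨[], by simp⟩
  | succ t ih =>
    obtain ⟨l, hlen, hC, hd⟩ | ⟨D, hD, h⟩ := ih
    · by_cases hex : ∃ c, C c ∧ ∀ c' ∈ l, Disjoint (tripleSupport c) (tripleSupport c')
      · obtain ⟨c, hc, hc'⟩ := hex
        exact Or.inl ⟨c :: l, by simp [hlen], List.forall_mem_cons.2 ⟨hc, hC⟩,
          List.pairwise_cons.2 ⟨hc', hd⟩⟩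
      · refine Or.inr ⟨l.toFinset.biUnion tripleSupport, ?_, ?_⟩
        · refine (card_biUnion_le_card_mul _ _ 3 fun c _ => card_le_three).trans ?_
          have := l.toFinset_card_le
          omega
        · intro c hc hdis
          refine hex ⟨c, hc, fun c' hc' => ?_⟩
          exact (disjoint_biUnion_right _ _ _).1 hdis c' (List.mem_toFinset.2 hc')
    · exact Or.inr ⟨D, by omega, h⟩

/-- If every edge of a highly connected set carries one of two colours and few points meet all
two-coloured cherries, then few points meet all edges of one of the colours. -/
theorem monochromatic_of_cover {V : Type} [DecidableEq V] {R : V → V → Prop} [DecidableRel R]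
    {k : ℕ} {A : Finset V} (hirr : ∀ u, ¬ R u u) (hsymm : ∀ u v, R u v → R v u)
    (hdeg : ∀ u ∈ A, 2 * k < (A.filter (R u)).card)
    (hsep : ∀ (D : Finset V) (P : V → Prop), D.card ≤ k →
        (∀ u ∈ A, u ∉ D → P u → ∀ w ∈ A, w ∉ D → ¬ P w → ¬ R u w) →
        (∀ u ∈ A, u ∉ D → P u) ∨ (∀ u ∈ A, u ∉ D → ¬ P u))
    {c₁ c₂ : V → V → Prop} (hc₁ : ∀ u v, c₁ u v → c₁ v u)
    (hcol : ∀ u v, R u v → c₁ u v ∨ c₂ u v)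
    {D : Finset V} (hDk : D.card + 1 ≤ k)
    (hD : ∀ c : V × V × V, DistinctTriple c ∧ c₁ c.1 c.2.1 ∧ c₂ c.1 c.2.2 →
      ¬ Disjoint (tripleSupport c) D) :
    (∀ u ∈ A, u ∉ D → ∀ v ∈ A, v ∉ D → R u v → ¬ c₁ u v) ∨
    (∀ u ∈ A, u ∉ D → ∀ v ∈ A, v ∉ D → R u v → ¬ c₂ u v) := by
  have hne : ∀ u v, R u v → u ≠ v := fun u v h e => hirr u (e ▸ h)
  have hcherry : ∀ u v w, u ∉ D → v ∉ D → w ∉ D → R u v → R u w → v ≠ w → c₁ u v → ¬ c₂ u w := by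
    intro u v w hu hv hw huv huw hvw h1 h2
    refine hD (u, v, w) ⟨⟨hne _ _ huv, hne _ _ huw, hvw⟩, h1, h2⟩ ?_
    simp [tripleSupport, hu, hv, hw]
  rcases hsep D (fun u => ∃ v ∈ A, v ∉ D ∧ R u v ∧ c₁ u v) (by omega) (by
    rintro u huA huD ⟨v, hvA, hvD, huv, h1⟩ w hwA hwD hw huw
    have hn1 : ¬ c₁ u w := fun h => hw ⟨u, huA, huD, hsymm _ _ huw, hc₁ _ _ h⟩
    have h2 : c₂ u w := (hcol _ _ huw).resolve_left hn1
    exact hcherry u v w huD hvD hwD huv huw (fun e => hn1 (e ▸ h1)) h1 h2) with hall | hnone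
  · right
    intro u huA huD w hwA hwD huw h2
    obtain ⟨v, hvA, hvD, huv, h1⟩ := hall u huA huD
    by_cases hvw : v = w
    · subst hvw
      obtain ⟨x, hx, hxn⟩ : ∃ x ∈ A.filter (R u), x ∉ insert v D := by
        apply Finset.exists_mem_notMem_of_card_lt_card
        have := Finset.card_insert_le v D
        have := hdeg u huA
        omega
      obtain ⟨hxA, hux⟩ := Finset.mem_filter.1 hx
      simp only [Finset.mem_insert, not_or] at hxn
      rcases hcol u x hux with h | h
      · exact hcherry u x v huD hxn.2 hvD hux huv hxn.1 h h2
      · exact hcherry u v x huD hvD hxn.2 huv hux (Ne.symm hxn.1) h1 h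
    · exact hcherry u v w huD hvD hwD huv huw hvw h1 h2
  · left
    intro u huA huD v hvA hvD huv h1
    exact hnone u huA huD ⟨v, hvA, hvD, huv, h1⟩

namespace BP

variable {V : Type} (Z : BP (PsiVar V))

/-- The edge `e` is labelled with a positive literal of the clause of `{u, v}`. -/
def Hits (u v : V) (e : Fin Z.m) : Prop :=
  Z.label e = some (Sum.inl u, true) ∨ Z.label e = some (Sum.inr s(u, v), true) ∨
    Z.label e = some (Sum.inl v, true)

/-- Every path from `p` to `q` carries a positive literal of the clause of `{u, v}`. -/
def Forces (p q : Fin Z.n) (u v : V) : Prop :=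
  ∀ π, Z.IsPathFrom p q π → ∃ e ∈ π, Z.Hits u v e

variable {Z}

theorem isPathFrom_append {p q : Fin Z.n} {π ρ : List (Fin Z.m)} :
    Z.IsPathFrom p q (π ++ ρ) ↔ ∃ x, Z.IsPathFrom p x π ∧ Z.IsPathFrom x q ρ := by
  induction π generalizing p with
  | nil => simp [IsPathFrom]
  | cons e π ih => simp [IsPathFrom, ih, and_assoc]

theorem Hits.symm {u v : V} {e : Fin Z.m} (h : Z.Hits u v e) : Z.Hits v u e := by
  unfold Hits at *
  rw [Sym2.eq_swap]
  tauto

theorem Forces.symm {p q : Fin Z.n} {u v : V} (h : Z.Forces p q u v) : Z.Forces p q v u :=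
  fun π hπ => (h π hπ).imp fun _ he => ⟨he.1, he.2.symm⟩

theorem Forces.split {p q : Fin Z.n} {u v : V} (h : Z.Forces p q u v) (x : Fin Z.n) :
    Z.Forces p x u v ∨ Z.Forces x q u v := by
  by_contra! hcon
  simp only [Forces, not_forall] at hcon
  obtain ⟨⟨π, hπ, hπ'⟩, ⟨ρ, hρ, hρ'⟩⟩ := hcon
  obtain ⟨e, he, hh⟩ := h (π ++ ρ) (isPathFrom_append.2 ⟨x, hπ, hρ⟩)
  rcases List.mem_append.1 he with he | he
  · exact hπ' ⟨e, he, hh⟩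
  · exact hρ' ⟨e, he, hh⟩

theorem not_forces_self (p : Fin Z.n) (u v : V) : ¬ Z.Forces p p u v := by
  intro h
  obtain ⟨e, he, -⟩ := h [] rfl
  simp at he

theorem forces_source_sink {G : SimpleGraph V} (hmono : Z.MonotoneBP) (hrep : RepresentsPsi G Z)
    {u v : V} (huv : G.Adj u v) : Z.Forces Z.source Z.sink u v := by
  classical
  intro π hπ
  have hsat : Z.Sat fun y => decide (∃ e ∈ π, Z.label e = some (y, true)) := by
    refine ⟨π, hπ, ?_⟩
    rintro e he ⟨y, b⟩ hl
    obtain rfl : b = true := hmono e _ hl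
    simpa using ⟨e, he, hl⟩
  have := (hrep _).1 hsat huv
  simp only [decide_eq_true_eq] at this
  rcases this with ⟨e, he, hl⟩ | ⟨e, he, hl⟩ | ⟨e, he, hl⟩
  · exact ⟨e, he, Or.inl hl⟩
  · exact ⟨e, he, Or.inr (Or.inl hl)⟩
  · exact ⟨e, he, Or.inr (Or.inr hl)⟩

/-- All clauses satisfied by a single edge share a vertex. -/
theorem exists_common_of_hits [Nonempty V] (e : Fin Z.m) :
    ∃ w : V, ∀ u v, Z.Hits u v e → u = w ∨ v = w := by
  rcases hl : Z.label e with _ | ⟨w | z, b⟩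
  · exact ⟨Classical.arbitrary V, fun u v h => by simp [Hits, hl] at h⟩
  · refine ⟨w, fun u v h => ?_⟩
    simp only [Hits, hl, Option.some.injEq, Prod.mk.injEq, Sum.inl.injEq, reduceCtorEq,
      false_and, false_or] at h
    rcases h with h | h
    · exact Or.inl h.1.symm
    · exact Or.inr h.1.symm
  · induction z with
    | _ a b' =>
      refine ⟨a, fun u v h => ?_⟩
      simp only [Hits, hl, Option.some.injEq, Prod.mk.injEq, Sum.inr.injEq, reduceCtorEq,
        false_and, false_or, or_false, Sym2.eq_iff] at h
      rcases h.1 with h | h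
      · exact Or.inl h.1.symm
      · exact Or.inr h.1.symm

open Finset in
/-- If a path is cut into `ps.length` pieces, then one of the pieces forces a fraction of at least
`1 / ps.length` of the forced pairs. -/
theorem exists_piece_forcing (E : Finset (V × V)) (hE : E.Nonempty) (ps : List (List (Fin Z.m)))
    (p q : Fin Z.n) (hps : Z.IsPathFrom p q ps.flatten)
    (hforce : ∀ c ∈ E, Z.Forces p q c.1 c.2) :
    ∃ z z' π, π ∈ ps ∧ Z.IsPathFrom z z' π ∧
      ∃ E' ⊆ E, (∀ c ∈ E', Z.Forces z z' c.1 c.2) ∧ #E ≤ ps.length * #E' := by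
  classical
  induction ps generalizing p E with
  | nil =>
    obtain ⟨c, hc⟩ := hE
    obtain rfl : p = q := hps
    exact (not_forces_self _ _ _ (hforce c hc)).elim
  | cons π ps ih =>
    rw [List.flatten_cons, isPathFrom_append] at hps
    obtain ⟨x, hπ, hps⟩ := hps
    let E₁ : Finset (V × V) := {c ∈ E | Z.Forces p x c.1 c.2}
    let E₂ : Finset (V × V) := {c ∈ E | ¬ Z.Forces p x c.1 c.2}
    have hsum : #E₁ + #E₂ = #E := card_filter_add_card_filter_not _
    have h₁ : ∀ c ∈ E₁, Z.Forces p x c.1 c.2 := fun c hc => (mem_filter.1 hc).2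
    by_cases hle : #E ≤ (π :: ps).length * #E₁
    · exact ⟨p, x, π, List.mem_cons_self, hπ, E₁, filter_subset _ _, h₁, hle⟩
    · rw [List.length_cons] at hle
      have hne : E₂.Nonempty := by
        rw [nonempty_iff_ne_empty]
        intro h0
        rw [h0, card_empty] at hsum
        nlinarith
      obtain ⟨z, z', ρ, hρ, hzz, E', hE', hf, hc⟩ := ih E₂ hne x hps (fun c hc =>
        ((hforce c (mem_filter.1 hc).1).split x).resolve_left (mem_filter.1 hc).2)
      refine ⟨z, z', ρ, List.mem_cons_of_mem _ hρ, hzz, E', hE'.trans (filter_subset _ _), hf, ?_⟩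
      rw [List.length_cons]
      have h2 : #E₁ ≤ #E' := by
        by_contra! hlt
        have : ps.length * #E' ≤ ps.length * #E₁ := Nat.mul_le_mul_left _ hlt.le
        nlinarith
      nlinarith

/-- Walking along a path, a property that fails at the start and holds at the end
has a first step at which it becomes true. -/
theorem exists_step {T : Fin Z.n → Prop} {z z' : Fin Z.n} {π : List (Fin Z.m)}
    (hπ : Z.IsPathFrom z z' π) (hz : T z) (hz' : ¬ T z') :
    ∃ π₁ e π₂, π = π₁ ++ e :: π₂ ∧ Z.IsPathFrom z (Z.esrc e) π₁ ∧
      Z.IsPathFrom (Z.edst e) z' π₂ ∧ T (Z.esrc e) ∧ ¬ T (Z.edst e) := by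
  induction π generalizing z with
  | nil => exact (hz' ((show z = z' from hπ) ▸ hz)).elim
  | cons e π ih =>
    obtain ⟨rfl, hπ⟩ := hπ
    by_cases h : T (Z.edst e)
    · obtain ⟨π₁, e', π₂, rfl, h1, h2, h3, h4⟩ := ih hπ h
      exact ⟨e :: π₁, e', π₂, rfl, ⟨rfl, h1⟩, h2, h3, h4⟩
    · exact ⟨[], e, π, rfl, rfl, hπ, hz, h⟩

/-- The pair of the centre with its first companion is forced before `x`, and that with its second
companion after `x`. -/
def Cherry (Z : BP (PsiVar V)) (z x z' : Fin Z.n) (c : V × V × V) : Prop :=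
  DistinctTriple c ∧ Z.Forces z x c.1 c.2.1 ∧ Z.Forces x z' c.1 c.2.2

open Finset in
theorem exists_cherry_packing [Fintype V] [DecidableEq V] (t : ℕ)
    (hV : 2 * (3 * t + 1) ≤ Fintype.card V) {z z' : Fin Z.n} (E : Finset (V × V))
    (hE : ∀ c ∈ E, c.1 ≠ c.2 ∧ Z.Forces z z' c.1 c.2)
    (hcard : 4 * (3 * t + 1) * Fintype.card V ≤ #E)
    {π : List (Fin Z.m)} (hπ : Z.IsPathFrom z z' π) :
    ∃ π₁ π₂ x, π = π₁ ++ π₂ ∧ Z.IsPathFrom z x π₁ ∧ Z.IsPathFrom x z' π₂ ∧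
      ∃ l : List (V × V × V), l.length = t ∧ (∀ c ∈ l, Z.Cherry z x z' c) ∧
        l.Pairwise fun c c' => Disjoint (tripleSupport c) (tripleSupport c') := by
  classical
  let R : V → V → Prop := fun u v => u ≠ v ∧ Z.Forces z z' u v
  have hirr : ∀ u, ¬ R u u := fun u h => h.1 rfl
  have hsymm : ∀ u v, R u v → R v u := fun u v h => ⟨h.1.symm, h.2.symm⟩
  obtain ⟨A, hA, hdeg, hsep⟩ := exists_highly_connected_subset R hsymm (3 * t + 1) hV (by
    have : #E ≤ #{p : V × V | R p.1 p.2} :=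
      card_le_card fun c hc => mem_filter.2 ⟨mem_univ _, hE c hc⟩
    have : 0 < 4 * (3 * t + 1) * (3 * t + 1) := by positivity
    omega)
  have hedge : ∀ D : Finset V, #D ≤ 6 * t + 1 →
      ∃ u ∈ A, u ∉ D ∧ ∃ v ∈ A, v ∉ D ∧ R u v := by
    intro D hD
    obtain ⟨u, hu, huD⟩ : ∃ u ∈ A, u ∉ D := exists_mem_notMem_of_card_lt_card (by omega)
    obtain ⟨v, hv, hvD⟩ := exists_mem_notMem_of_card_lt_card
      ((show #D < 2 * (3 * t + 1) by omega).trans (hdeg u hu))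
    exact ⟨u, hu, huD, v, (mem_filter.1 hv).1, hvD, (mem_filter.1 hv).2⟩
  have : Nonempty V := ⟨(hedge ∅ (by simp)).choose⟩
  let T₁ : Fin Z.n → Prop := fun x => ∃ D : Finset V, #D ≤ 3 * t ∧
    ∀ u ∈ A, u ∉ D → ∀ v ∈ A, v ∉ D → R u v → ¬ Z.Forces z x u v
  let T₂ : Fin Z.n → Prop := fun x => ∃ D : Finset V, #D ≤ 3 * t ∧
    ∀ u ∈ A, u ∉ D → ∀ v ∈ A, v ∉ D → R u v → ¬ Z.Forces x z' u v
  by_contra hcon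
  have hT : ∀ π₁ π₂ x, π = π₁ ++ π₂ → Z.IsPathFrom z x π₁ → Z.IsPathFrom x z' π₂ →
      T₁ x ∨ T₂ x := by
    intro π₁ π₂ x h1 h2 h3
    rcases exists_packing_or_cover (Z.Cherry z x z') t with hl | ⟨D, hD, hcov⟩
    · exact (hcon ⟨π₁, π₂, x, h1, h2, h3, hl⟩).elim
    · exact (monochromatic_of_cover hirr hsymm hdeg hsep (c₁ := Z.Forces z x)
        (c₂ := Z.Forces x z') (fun u v h => h.symm) (fun u v h => h.2.split x)
        (by omega) hcov).imp (fun h => ⟨D, hD, h⟩) (fun h => ⟨D, hD, h⟩)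
  have hz : T₁ z := ⟨∅, by simp, fun u _ _ v _ _ _ => not_forces_self _ _ _⟩
  have hz' : ¬ T₁ z' := by
    rintro ⟨D, hD, h⟩
    obtain ⟨u, hu, huD, v, hv, hvD, hR⟩ := hedge D (by omega)
    exact h u hu huD v hv hvD hR hR.2
  obtain ⟨π₁, e, π₂, rfl, h1, h2, ⟨D, hD, hD'⟩, h4⟩ := exists_step hπ hz hz'
  obtain ⟨D₂, hD₂, hD₂'⟩ : T₂ (Z.edst e) :=
    (hT (π₁ ++ [e]) π₂ _ (by simp) (isPathFrom_append.2 ⟨_, h1, rfl, rfl⟩) h2).resolve_left h4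
  obtain ⟨w, hw⟩ := exists_common_of_hits e
  obtain ⟨u, hu, huD, v, hv, hvD, hR⟩ := hedge (insert w (D ∪ D₂)) (by
    have := card_insert_le w (D ∪ D₂)
    have := card_union_le D D₂
    omega)
  simp only [mem_insert, mem_union, not_or] at huD hvD
  rcases hR.2.split (Z.esrc e) with h | h
  · exact hD' u hu huD.2.1 v hv hvD.2.1 hR h
  rcases h.split (Z.edst e) with h | h
  · obtain ⟨e', he', hh⟩ := h [e] ⟨rfl, rfl⟩
    rw [List.mem_singleton] at he'
    subst he'
    exact (hw u v hh).elim huD.1 hvD.1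
  · exact hD₂' u hu huD.2.2 v hv hvD.2.2 hR h

/-- The assignment making true the vertices of `S` and the edges disjoint from `S`. -/
def coverAssignment [DecidableEq V] (S : Finset V) : Assignment V :=
  Sum.elim (fun v => decide (v ∈ S)) (fun e => decide (∀ v ∈ S, v ∉ e))

theorem psiSat_coverAssignment [DecidableEq V] (G : SimpleGraph V) (S : Finset V) :
    psiSat G (coverAssignment S) := by
  intro u v _
  by_cases hu : u ∈ S
  · exact Or.inl (by simp [coverAssignment, hu])
  by_cases hv : v ∈ S
  · exact Or.inr (Or.inr (by simp [coverAssignment, hv]))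
  · refine Or.inr (Or.inl ?_)
    simp only [coverAssignment, Sum.elim_inr, decide_eq_true_eq, Sym2.mem_iff, not_or]
    exact fun w hw => ⟨fun h => hu (h ▸ hw), fun h => hv (h ▸ hw)⟩

theorem exists_label_of_forces [DecidableEq V] {S : Finset V} {u v : V} (hu : u ∈ S) (hv : v ∉ S)
    {p q : Fin Z.n} {π : List (Fin Z.m)} (hπ : Z.IsPathFrom p q π)
    (hagree : Z.PathAgrees π (coverAssignment S)) (h : Z.Forces p q u v) :
    ∃ e ∈ π, Z.label e = some (Sum.inl u, true) := by
  obtain ⟨e, he, hl | hl | hl⟩ := h π hπ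
  · exact ⟨e, he, hl⟩
  · have := hagree e he _ hl
    simp [coverAssignment] at this
    exact absurd (this u hu).1 (by simp)
  · have := hagree e he _ hl
    simp [coverAssignment, hv] at this

theorem not_centreOnly_of_cherry [DecidableEq V] {S : Finset V} {z x z' : Fin Z.n}
    {π₁ π₂ : List (Fin Z.m)} (h₁ : Z.IsPathFrom z x π₁) (h₂ : Z.IsPathFrom x z' π₂)
    (hro : Z.ReadOnce (π₁ ++ π₂)) (hagree : Z.PathAgrees (π₁ ++ π₂) (coverAssignment S))
    {c : V × V × V} (hc : Z.Cherry z x z' c) : ¬ CentreOnly S c := by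
  rintro ⟨hu, hv, hw⟩
  obtain ⟨e₁, he₁, hl₁⟩ := exists_label_of_forces hu hv h₁
    (fun e he => hagree e (List.mem_append_left _ he)) hc.2.1
  obtain ⟨e₂, he₂, hl₂⟩ := exists_label_of_forces hu hw h₂
    (fun e he => hagree e (List.mem_append_right _ he)) hc.2.2
  have h := hro (Sum.inl c.1)
  rw [varCount, List.countP_append] at h
  have p₁ : 0 < π₁.countP fun e => (Z.label e).elim false fun l => decide (l.1 = Sum.inl c.1) :=
    List.countP_pos_iff.2 ⟨e₁, he₁, by simp [hl₁]⟩
  have p₂ : 0 < π₂.countP fun e => (Z.label e).elim false fun l => decide (l.1 = Sum.inl c.1) :=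
    List.countP_pos_iff.2 ⟨e₂, he₂, by simp [hl₂]⟩
  omega

theorem card_nodes_le {X : Type} {Z : BP X} (hZ : Z.IsNBP) : Z.n ≤ Z.m + 1 := by
  classical
  have hsub : (Finset.univ : Finset (Fin Z.n)) ⊆
      insert Z.sink ((Finset.univ : Finset (Fin Z.m)).image Z.esrc) := by
    intro v _
    obtain ⟨π, hπ⟩ := (hZ.2.2.2 v).2
    cases π with
    | nil => exact Finset.mem_insert.2 (Or.inl hπ)
    | cons e π =>
      exact Finset.mem_insert_of_mem (Finset.mem_image.2 ⟨e, Finset.mem_univ _, hπ.1⟩)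
  have h1 := Finset.card_le_card hsub
  have h2 := Finset.card_insert_le Z.sink ((Finset.univ : Finset (Fin Z.m)).image Z.esrc)
  have h3 := Finset.card_image_le (s := (Finset.univ : Finset (Fin Z.m))) (f := Z.esrc)
  simp only [Finset.card_univ, Fintype.card_fin] at h1 h3
  omega

open Finset in
theorem eight_pow_le {n d t : ℕ} {Z : BP (PsiVar (Fin n))} (hZ : Z.IsSMNBP d)
    (hrep : RepresentsPsi (⊤ : SimpleGraph (Fin n)) Z)
    (hn : 4 * (3 * t + 1) * d + 1 ≤ n) (hd : 0 < d) :
    8 ^ t ≤ (Z.m + 1) ^ 3 * 7 ^ t := by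
  classical
  obtain ⟨hNBP, hmono, -, hsepa⟩ := hZ
  have hnt : 4 * (3 * t + 1) < n := by nlinarith
  let B : Fin Z.n × Fin Z.n × Fin Z.n → Finset (Finset (Fin n)) := fun y =>
    {S | (∃ l : List (Fin n × Fin n × Fin n), l.length = t ∧
      (∀ c ∈ l, Z.Cherry y.1 y.2.1 y.2.2 c) ∧
        l.Pairwise fun c c' => Disjoint (tripleSupport c) (tripleSupport c')) ∧
      ∀ c, Z.Cherry y.1 y.2.1 y.2.2 c → ¬ CentreOnly S c}
  have hB : ∀ y, 8 ^ t * #(B y) ≤ 7 ^ t * 2 ^ n := by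
    intro y
    by_cases hne : (B y).Nonempty
    · obtain ⟨S, hS⟩ := hne
      obtain ⟨l, hlen, hl, hdis⟩ := (mem_filter.1 hS).2.1
      have := card_forall_not_centreOnly_le l (fun c hc => (hl c hc).1) hdis (B y)
        (fun S hS c hc => (mem_filter.1 hS).2.2 c (hl c hc))
      simpa [hlen] using this
    · rw [not_nonempty_iff_eq_empty.1 hne]
      simp
  let E : Finset (Fin n × Fin n) := univ.offDiag
  have hEcard : #E = n * n - n := by simp [E, offDiag_card]
  have hEcard' : 4 * (3 * t + 1) * n * d ≤ #E := by
    rw [hEcard]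
    apply Nat.le_sub_of_add_le
    nlinarith
  have hEne : E.Nonempty := by
    rw [← card_pos]
    refine lt_of_lt_of_le ?_ hEcard'
    have : 0 < n := by omega
    positivity
  have hcover : (univ : Finset (Finset (Fin n))) ⊆ univ.biUnion B := by
    intro S _
    obtain ⟨P, hP, hagree⟩ := (hrep (coverAssignment S)).2 (psiSat_coverAssignment _ S)
    obtain ⟨ps, hlen, rfl, hro⟩ := hsepa P hP
    obtain ⟨z, z', π, hπ, hzz, E', hE', hf, hc⟩ := exists_piece_forcing E hEne ps _ _ hP
      (fun c hc => forces_source_sink hmono hrep (by simpa [E] using hc))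
    obtain ⟨π₁, π₂, x, rfl, h1, h2, hl⟩ := exists_cherry_packing t (by simp; omega) E'
      (fun c hc => ⟨by simpa [E] using hE' hc, hf c hc⟩) (by
        rw [Fintype.card_fin]
        have : 4 * (3 * t + 1) * n * d ≤ #E' * d := by
          refine hEcard'.trans (hc.trans ?_)
          rw [mul_comm]
          exact Nat.mul_le_mul_left _ hlen
        exact Nat.le_of_mul_le_mul_right this hd) hzz
    refine mem_biUnion.2 ⟨(z, x, z'), mem_univ _, mem_filter.2 ⟨mem_univ _, hl, fun c hc => ?_⟩⟩
    exact not_centreOnly_of_cherry h1 h2 (hro _ hπ)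
      (fun e he => hagree e (List.mem_flatten.2 ⟨_, hπ, he⟩)) hc
  have hcount : 2 ^ n ≤ ∑ y, #(B y) := by
    simpa using (card_le_card hcover).trans card_biUnion_le
  have hsum : 8 ^ t * 2 ^ n ≤ Z.n ^ 3 * 7 ^ t * 2 ^ n := by
    calc 8 ^ t * 2 ^ n ≤ 8 ^ t * ∑ y, #(B y) := Nat.mul_le_mul_left _ hcount
      _ = ∑ y, 8 ^ t * #(B y) := mul_sum _ _ _
      _ ≤ ∑ _y : Fin Z.n × Fin Z.n × Fin Z.n, 7 ^ t * 2 ^ n := sum_le_sum fun y _ => hB y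
      _ = Z.n ^ 3 * 7 ^ t * 2 ^ n := by simp; ring
  refine (Nat.le_of_mul_le_mul_right hsum (by positivity)).trans ?_
  exact Nat.mul_le_mul_right _ (Nat.pow_le_pow_left (card_nodes_le hNBP) 3)

end BP

open Filter in
theorem eventually_parameters (a b : ℝ) (ha : 0 < a) (hb : 0 < b) (hab : a + b < 1) :
    ∀ᶠ n : ℕ in atTop, 0 < ⌊(n : ℝ) ^ a⌋₊ ∧ ∃ t : ℕ,
      4 * (3 * t + 1) * ⌊(n : ℝ) ^ a⌋₊ + 1 ≤ n ∧ 18 + (n : ℝ) ^ b / 4 ≤ t := by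
  have hcast := tendsto_natCast_atTop_atTop (R := ℝ)
  have h₁ : ∀ᶠ n : ℕ in atTop, 24 * 20 ≤ (n : ℝ) ^ (1 - a - b) :=
    ((tendsto_rpow_atTop (by linarith)).comp hcast).eventually_ge_atTop _
  have h₂ : ∀ᶠ n : ℕ in atTop, 20 ≤ (n : ℝ) ^ b :=
    ((tendsto_rpow_atTop hb).comp hcast).eventually_ge_atTop _
  filter_upwards [h₁, h₂, eventually_ge_atTop 1] with n h₁ h₂ hn
  have hn' : (1 : ℝ) ≤ n := by exact_mod_cast hn
  have hn0 : (0 : ℝ) < n := by linarith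
  have hna : 1 ≤ (n : ℝ) ^ a := Real.one_le_rpow hn' ha.le
  have hsplit : (n : ℝ) ^ (1 - a) = (n : ℝ) ^ (1 - a - b) * (n : ℝ) ^ b := by
    rw [← Real.rpow_add hn0]; congr 1; ring
  have hprod : (n : ℝ) ^ a * (n : ℝ) ^ (1 - a) = n := by
    rw [← Real.rpow_add hn0]; simp
  have hd : (⌊(n : ℝ) ^ a⌋₊ : ℝ) ≤ (n : ℝ) ^ a := Nat.floor_le (by positivity)
  set x := (n : ℝ) ^ (1 - a)
  set y := (n : ℝ) ^ b
  have hx : 24 * 20 * y ≤ x := by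
    rw [hsplit]; exact mul_le_mul_of_nonneg_right h₁ (by positivity)
  have ht : (⌊x / 24⌋₊ : ℝ) ≤ x / 24 := Nat.floor_le (by positivity)
  have ht' : x / 24 < ⌊x / 24⌋₊ + 1 := Nat.lt_floor_add_one _
  refine ⟨Nat.floor_pos.2 hna, ⌊x / 24⌋₊, ?_, by linarith⟩
  have hbound : (4 * (3 * (⌊x / 24⌋₊ : ℝ) + 1) * ⌊(n : ℝ) ^ a⌋₊ + 1) ≤ n := by
    calc (4 * (3 * (⌊x / 24⌋₊ : ℝ) + 1) * ⌊(n : ℝ) ^ a⌋₊ + 1)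
        ≤ 4 * (3 * (x / 24) + 1) * (n : ℝ) ^ a + (n : ℝ) ^ a := by gcongr
      _ = (x / 2 + 5) * (n : ℝ) ^ a := by ring
      _ ≤ x * (n : ℝ) ^ a := by gcongr; linarith
      _ = n := by rw [mul_comm, hprod]
  exact_mod_cast hbound

theorem rpow_le_of_eight_pow_le {t m : ℕ} {y : ℝ} (hy : 0 ≤ y) (ht : 18 + y / 4 ≤ t)
    (h : 8 ^ t ≤ (m + 1) ^ 3 * 7 ^ t) : ((8 / 7 : ℝ) ^ ((1 : ℝ) / 12)) ^ y ≤ m := by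
  have h' : (8 / 7 : ℝ) ^ t ≤ ((m : ℝ) + 1) ^ 3 := by
    rw [div_pow, div_le_iff₀ (by positivity)]
    exact_mod_cast h
  rw [← Real.rpow_mul (by norm_num)]
  set β := (8 / 7 : ℝ) ^ ((1 : ℝ) / 12 * y) with hβ
  have hβ1 : 1 ≤ β := Real.one_le_rpow (by norm_num) (by positivity)
  have hpow : ((8 / 7 : ℝ) ^ 6 * β) ^ 3 ≤ ((m : ℝ) + 1) ^ 3 := by
    refine le_trans ?_ h'
    rw [hβ, ← Real.rpow_natCast (8 / 7 : ℝ) 6, ← Real.rpow_add (by norm_num),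
      ← Real.rpow_natCast _ 3, ← Real.rpow_mul (by norm_num), ← Real.rpow_natCast _ t]
    refine Real.rpow_le_rpow_of_exponent_le (by norm_num) ?_
    push_cast
    linarith
  have hle : (8 / 7 : ℝ) ^ 6 * β ≤ m + 1 :=
    le_of_pow_le_pow_left₀ (by norm_num) (by positivity) hpow
  have : (2 : ℝ) ≤ (8 / 7) ^ 6 := by norm_num
  nlinarith

/-- for constants `0 < a`, `0 < b` with `a + b < 1`, every
`⌊n^a⌋`-SMNBP representing `ψ(K_n)` has at least `c·β^(n^b)` edges for all
sufficiently large `n`, where `β = (8/7)^(1/12)`. -/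
theorem smnbp_lower_bound_complete_graph (a b : ℝ) (ha : 0 < a) (hb : 0 < b)
    (hab : a + b < 1) :
    ∃ c : ℝ, 0 < c ∧ ∃ N : ℕ, ∀ n : ℕ, N ≤ n →
      ∀ Z : BP (PsiVar (Fin n)),
        Z.IsSMNBP (Nat.floor ((n : ℝ) ^ a)) →
        RepresentsPsi (⊤ : SimpleGraph (Fin n)) Z →
        c * ((8 / 7 : ℝ) ^ ((1 : ℝ) / 12)) ^ ((n : ℝ) ^ b) ≤ (Z.m : ℝ) := by
  obtain ⟨N, hN⟩ := Filter.eventually_atTop.1 (eventually_parameters a b ha hb hab)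
  refine ⟨1, one_pos, N, fun n hn Z hZ hrep => ?_⟩
  obtain ⟨hd, t, hsize, ht⟩ := hN n hn
  rw [one_mul]
  exact rpow_le_of_eight_pow_le (by positivity) ht (BP.eight_pow_le hZ hrep hsize hd)
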